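/- arXiv:1401.2518 — 5 statements merged into one kernel-verified Lean document; each statement's English description precedes it below -/
import Mathlib

section
/- Let (H, ≺, τ, p, m) be a PCS-FM instance with unit-length tasks, and suppose it has a schedule meeting deadline D' ∈ ℕ. Let the computation graph G be the precedence DAG (H, ≺) with unit edge weights, let the network N be the complete graph on the m processors with every edge weight ε = 1/|H|², let the processing delay be P(h,u) = 1 for every task h and processor u, and require embeddings to map each task h ∈ τ to the processor p(h). Then the embedding E defined by mapping each task to the processor executing it in the schedule is such an embedding, and its delay satisfies d(E) < D' + 1. -/
/-- The delay of a map `E` from the tasks of the computation DAG (edge relation `edge`,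
well-founded since the DAG is finite and acyclic) into the network, evaluated at a vertex:
it is `0` at vertices without predecessors (minimal tasks), and otherwise the maximum over
predecessors `ω'` of `[d(E ω') + w(ω',ω) · dist(E ω', E ω)]` plus the processing delay
`P ω (E ω)`. -/
noncomputable def netDelay {Ω V : Type*} [Fintype Ω]
    (edge : Ω → Ω → Prop) [DecidableRel edge] (hwf : WellFounded edge)
    (w : Ω → Ω → ℝ) (P : Ω → V → ℝ) (dist : V → V → ℝ) (E : Ω → V) : Ω → ℝ :=
  hwf.fix fun ω ih =>
    if h : (Finset.univ.filter fun ω' => edge ω' ω).Nonempty then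
      (Finset.univ.filter fun ω' => edge ω' ω).sup' h
        (fun ω' => (if he : edge ω' ω then ih ω' he else 0)
          + w ω' ω * dist (E ω') (E ω)) + P ω (E ω)
    else 0

/-- A nonnegative potential that grows along every edge by at least the cost of that edge bounds
the delay from above. -/
theorem netDelay_le_of_potential {Ω V : Type*} [Fintype Ω]
    (edge : Ω → Ω → Prop) [DecidableRel edge] (hwf : WellFounded edge)
    (w : Ω → Ω → ℝ) (P : Ω → V → ℝ) (dist : V → V → ℝ) (E : Ω → V) (f : Ω → ℝ)
    (hf : ∀ ω, 0 ≤ f ω)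
    (hstep : ∀ ω' ω, edge ω' ω → f ω' + w ω' ω * dist (E ω') (E ω) + P ω (E ω) ≤ f ω) (ω : Ω) :
    netDelay edge hwf w P dist E ω ≤ f ω := by
  induction ω using hwf.induction with
  | _ ω ih =>
    rw [netDelay, hwf.fix_eq]
    split_ifs with h
    · rw [← le_sub_iff_add_le]
      refine Finset.sup'_le h _ fun ω' hω' => ?_
      have he : edge ω' ω := (Finset.mem_filter.mp hω').2
      have hle : netDelay edge hwf w P dist E ω' ≤ f ω' := ih ω' he
      rw [netDelay] at hle
      rw [dif_pos he]
      linarith [hstep ω' ω he]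
    · exact hf ω

/-- From a PCS-FM schedule `(σ, π)` with unit-length tasks meeting deadline `D'` one obtains
an embedding of the precedence DAG (unit edge weights, unit processing delays) into the
complete network on the `m` processors with all edge weights `ε = 1/|H|²` (so the
shortest-path distance between distinct processors is `ε`): the map `E = π` respects the
fixed mapping `p` on `τ`, and its delay—the maximum of the vertex delays over the maximal
tasks—is strictly less than `D' + 1`. -/
theorem pcsfm_schedule_gives_embedding
    {H : Type*} [Fintype H] [DecidableEq H]
    (prec : H → H → Prop) [DecidableRel prec]
    (htrans : Transitive prec) (hirrefl : Irreflexive prec)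
    (hwf : WellFounded prec)
    (m : ℕ) (τ : Set H) (p : H → Fin m)
    (D' : ℕ)
    (σ : H → ℕ) (π : H → Fin m)
    (hconflict : ∀ h h', h ≠ h' → σ h = σ h' → π h ≠ π h')
    (hprec : ∀ h h', prec h h' → σ h + 1 ≤ σ h')
    (hfix : ∀ h ∈ τ, π h = p h)
    (hdeadline : ∀ h, σ h + 1 ≤ D') :
    (∀ h ∈ τ, π h = p h) ∧
    ∀ h, (∀ h', ¬ prec h h') →
      netDelay prec hwf (fun _ _ => (1 : ℝ)) (fun _ _ => (1 : ℝ))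
        (fun u v : Fin m => if u = v then 0 else 1 / (Fintype.card H : ℝ) ^ 2) π h
        < (D' : ℝ) + 1 := by
  refine ⟨hfix, fun h _ => ?_⟩
  set ε : ℝ := 1 / (Fintype.card H : ℝ) ^ 2 with hε
  have hε0 : 0 ≤ ε := by positivity
  let k : H → ℕ := fun x => (Finset.univ.filter fun y => prec y x).card
  have hk : ∀ x y, prec x y → k x + 1 ≤ k y := fun x y hxy =>
    Finset.card_lt_card <| (Finset.ssubset_iff_of_subset fun z hz => by
      simp only [Finset.mem_filter, Finset.mem_univ, true_and] at hz ⊢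
      exact htrans hz hxy).mpr ⟨x, by simpa using hxy, by simpa using hirrefl x⟩
  have hbound := netDelay_le_of_potential prec hwf (fun _ _ => (1 : ℝ)) (fun _ _ => (1 : ℝ))
    (fun u v : Fin m => if u = v then 0 else ε) π (fun x => (σ x : ℝ) + ε * k x)
    (fun x => by positivity)
    (fun x y hxy => by
      have hdist : (if π x = π y then 0 else ε) ≤ ε := by split_ifs <;> simp [hε0]
      have hσ : (σ x : ℝ) + 1 ≤ σ y := by exact_mod_cast hprec x y hxy
      have hkR : (k x : ℝ) + 1 ≤ k y := by exact_mod_cast hk x y hxy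
      have hmul := mul_le_mul_of_nonneg_left hkR hε0
      linarith) h
  have hcard : (1 : ℝ) ≤ Fintype.card H := by
    exact_mod_cast Fintype.card_pos_iff.mpr ⟨h⟩
  have hkcard : (k h : ℝ) ≤ Fintype.card H := by exact_mod_cast Finset.card_le_univ _
  have hεk : ε * k h ≤ 1 := by
    rw [hε, one_div_mul_eq_div, div_le_one (by positivity)]
    nlinarith
  have hD : (σ h : ℝ) + 1 ≤ D' := by exact_mod_cast hdeadline h
  linarith
end

section
/- Let G' = (V', E') be a finite simple graph with distinct terminal vertices s₁,…,s_k ∈ V'. Then the minimum, over all maps f: V' → {1,…,k} with f(s_i) = i for each i, of the number of edges {u,v} ∈ E' with f(u) ≠ f(v), equals the minimum size of a multiterminal cut of G'. Equivalently, the minimum-cost embedding of G' (with unit edge weights and zero processing costs, with s_i required to map to the i-th vertex) into the complete graph on k vertices with unit edge weights has cost equal to the minimum multiterminal cut size. -/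
namespace SimpleGraph

variable {V α : Type*} {G : SimpleGraph V}

/-- A map that agrees on the endpoints of every edge is constant on connected components. -/
theorem Reachable.map_eq_of_forall_adj {f : V → α} (hf : ∀ u v, G.Adj u v → f u = f v)
    {u v : V} (h : G.Reachable u v) : f u = f v := by
  obtain ⟨p⟩ := h
  induction p with
  | nil => rfl
  | cons hadj _ ih => exact (hf _ _ hadj).trans ih

/-- If the terminals `s i` lie in pairwise distinct connected components, then some labelling of
the vertices sends `s i` to `i` and is constant along edges. -/
theorem exists_labelling_of_not_reachable [Nonempty α] (s : α → V)
    (h : ∀ i j, i ≠ j → ¬ G.Reachable (s i) (s j)) :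
    ∃ f : V → α, (∀ i, f (s i) = i) ∧ ∀ u v, G.Adj u v → f u = f v := by
  have hinj : Function.Injective fun i => G.connectedComponentMk (s i) := fun i j hij =>
    by_contra fun hne => h i j hne (ConnectedComponent.eq.mp hij)
  refine ⟨fun v => Function.invFun (fun i => G.connectedComponentMk (s i))
    (G.connectedComponentMk v), fun i => Function.leftInverse_invFun hinj i, fun u v huv => ?_⟩
  simp only [ConnectedComponent.eq.mpr huv.reachable]

end SimpleGraph


/-- The minimum, over all maps `f : V' → {1,…,k}` fixing the terminals (`f (s i) = i`), of the
number of edges of `G` whose endpoints get different values under `f` — that is, the minimum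
cost of an embedding of `G` (unit edge weights, zero processing costs, terminal `s i` mapped
to the `i`-th vertex) into the complete graph on `k` vertices with unit edge weights — equals
the minimum size of a multiterminal cut of `G` with terminals `s 1, …, s k`. -/
theorem minCost_embedding_eq_multiterminal_cut
    {V' : Type*} [Fintype V'] [DecidableEq V'] (G : SimpleGraph V')
    [DecidableRel G.Adj]
    (k : ℕ) (s : Fin k → V') (hs : Function.Injective s) :
    sInf {n : ℕ | ∃ f : V' → Fin k, (∀ i, f (s i) = i) ∧
        n = (G.edgeFinset.filter fun e => ¬ (e.map f).IsDiag).card}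
      = sInf {n : ℕ | ∃ Es : Finset (Sym2 V'), ↑Es ⊆ G.edgeSet ∧
          (∀ i j : Fin k, i ≠ j → ¬ (G.deleteEdges ↑Es).Reachable (s i) (s j)) ∧
          n = Es.card} := by
  apply le_antisymm
  · refine le_csInf ⟨_, G.edgeFinset, by simp, fun i j hij h => ?_, rfl⟩ ?_
    · refine hij (hs (h.map_eq_of_forall_adj (f := id) fun u v huv => ?_))
      simp at huv
    rintro _ ⟨Es, -, hcut, rfl⟩
    rcases isEmpty_or_nonempty (Fin k) with hk | hk
    · refine le_of_eq_of_le (Nat.sInf_eq_zero.mpr ?_) (Nat.zero_le _)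
      refine (Set.eq_empty_or_nonempty _).symm.imp_left ?_
      rintro ⟨_, f, hf, rfl⟩
      have : IsEmpty V' := f.isEmpty
      exact ⟨f, hf, by simp [Finset.eq_empty_of_isEmpty]⟩
    · obtain ⟨f, hf, hadj⟩ := SimpleGraph.exists_labelling_of_not_reachable s hcut
      refine le_trans (Nat.sInf_le ⟨f, hf, rfl⟩) (Finset.card_le_card fun e he => ?_)
      induction e with | _ u v
      simp only [Finset.mem_filter, SimpleGraph.mem_edgeFinset, SimpleGraph.mem_edgeSet,
        Sym2.map_mk, Sym2.mk_isDiag_iff] at he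
      by_contra hmem
      exact he.2 (hadj u v (SimpleGraph.deleteEdges_adj.mpr ⟨he.1, hmem⟩))
  · rcases isEmpty_or_nonempty (Fin k) with hk | hk
    · exact le_trans (Nat.sInf_le ⟨∅, by simp, fun i => hk.elim i, rfl⟩) (Nat.zero_le _)
    obtain ⟨f₀, hf₀⟩ := hs.hasLeftInverse
    refine le_csInf ⟨_, f₀, hf₀, rfl⟩ ?_
    rintro _ ⟨f, hf, rfl⟩
    refine Nat.sInf_le ⟨_, fun e he => ?_, fun i j hij h => hij ?_, rfl⟩
    · exact SimpleGraph.mem_edgeFinset.mp (Finset.mem_filter.mp he).1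
    · rw [← hf i, ← hf j]
      refine h.map_eq_of_forall_adj fun u v huv => ?_
      rw [SimpleGraph.deleteEdges_adj] at huv
      by_contra hne
      exact huv.2 (by simp [huv.1, hne])
end

section
/- Suppose the computation graph G is a directed tree in which every non-root vertex has exactly one outgoing edge, the leaves are exactly the sources ω₁,…,ω_K, and the root is the sink ω_p. Define h recursively: for each source ω_i, h(ω_i, v) = 0 if v = s_i and h(ω_i, v) = +∞ otherwise; for each non-source vertex ω and each v ∈ V, h(ω, v) = P(ω, v) + max over predecessors ω' of ω of [min over u ∈ V of (h(ω', u) + w(ω',ω)·D_{u,v})]. Then the minimum of the delay d(E) over all embeddings E of G into N equals h(ω_p, t). -/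
/-- The dynamic-programming table of the minimum-delay algorithm for tree computation graphs:
`treeH … ω v` is `0` if `ω` is the source `ω i` and `v = s i`, `+∞` if `ω` is a source and
`v ≠ s i`, and otherwise
`P ω v + max over predecessors ω' of (min over u of (h(ω',u) + w(ω',ω)·dist(u,v)))`. -/
noncomputable def treeH {Ω V : Type*} [Fintype Ω] [Fintype V] [DecidableEq Ω] [DecidableEq V]
    [Nonempty V]
    (edge : Ω → Ω → Prop) [DecidableRel edge] (hwf : WellFounded edge)
    (w : Ω → Ω → ℝ) (P : Ω → V → ℝ) (dist : V → V → ℝ)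
    {K : ℕ} (src : Fin K → Ω) (s : Fin K → V) : Ω → V → EReal :=
  hwf.fix (C := fun _ => V → EReal) fun ω ih =>
    if hω : ∃ i, src i = ω then
      fun v => if v = s hω.choose then (0 : EReal) else ⊤
    else fun v =>
      ((P ω v : ℝ) : EReal) +
        (if h : (Finset.univ.filter fun ω' => edge ω' ω).Nonempty then
          (Finset.univ.filter fun ω' => edge ω' ω).sup' h fun ω' =>
            Finset.univ.inf' Finset.univ_nonempty fun u =>
              (if he : edge ω' ω then ih ω' he u else (0 : EReal))
                + ((w ω' ω * dist u v : ℝ) : EReal)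
        else 0)

section Unfolding

variable {Ω V : Type*} [Fintype Ω] (edge : Ω → Ω → Prop) [DecidableRel edge]
  (hwf : WellFounded edge) (w : Ω → Ω → ℝ) (P : Ω → V → ℝ) (dist : V → V → ℝ)

theorem netDelay_of_forall_not_edge (E : Ω → V) {ω : Ω} (h : ∀ ω', ¬ edge ω' ω) :
    netDelay edge hwf w P dist E ω = 0 := by
  rw [netDelay, hwf.fix_eq, dif_neg]
  simpa [Finset.filter_nonempty_iff] using h

theorem netDelay_of_nonempty (E : Ω → V) {ω : Ω}
    (h : (Finset.univ.filter fun ω' => edge ω' ω).Nonempty) :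
    netDelay edge hwf w P dist E ω =
      (Finset.univ.filter fun ω' => edge ω' ω).sup' h
        (fun ω' => netDelay edge hwf w P dist E ω' + w ω' ω * dist (E ω') (E ω)) + P ω (E ω) := by
  rw [netDelay, hwf.fix_eq, dif_pos h]
  congr 1
  refine Finset.sup'_congr h rfl fun ω' hω' => ?_
  rw [dif_pos (Finset.mem_filter.mp hω').2]

variable [Fintype V] [DecidableEq Ω] [DecidableEq V] [Nonempty V]
  {K : ℕ} {src : Fin K → Ω} (s : Fin K → V)

theorem treeH_src (hsrc : Function.Injective src) (i : Fin K) (v : V) :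
    treeH edge hwf w P dist src s (src i) v = if v = s i then 0 else ⊤ := by
  have hi : ∃ j, src j = src i := ⟨i, rfl⟩
  rw [treeH, hwf.fix_eq, dif_pos hi, hsrc hi.choose_spec]

theorem treeH_of_nonempty {ω : Ω} (hω : ¬ ∃ i, src i = ω)
    (h : (Finset.univ.filter fun ω' => edge ω' ω).Nonempty) (v : V) :
    treeH edge hwf w P dist src s ω v = ((P ω v : ℝ) : EReal) +
      (Finset.univ.filter fun ω' => edge ω' ω).sup' h fun ω' =>
        Finset.univ.inf' Finset.univ_nonempty fun u =>
          treeH edge hwf w P dist src s ω' u + ((w ω' ω * dist u v : ℝ) : EReal) := by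
  rw [treeH, hwf.fix_eq, dif_neg hω, dif_pos h]
  congr 1
  refine Finset.sup'_congr h rfl fun ω' hω' => ?_
  simp only [dif_pos (Finset.mem_filter.mp hω').2]

end Unfolding

theorem filter_edge_nonempty_of_not_src {Ω ι : Type*} [Fintype Ω] {edge : Ω → Ω → Prop}
    [DecidableRel edge] {src : ι → Ω} (hleaves : ∀ ω, (¬ ∃ ω', edge ω' ω) ↔ ∃ i, src i = ω)
    {ω : Ω} (hω : ¬ ∃ i, src i = ω) : (Finset.univ.filter fun ω' => edge ω' ω).Nonempty := by
  simpa [Finset.filter_nonempty_iff] using not_not.mp (mt (hleaves ω).mp hω)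

section DynamicProgram

variable {Ω V : Type*} [Fintype Ω] [Fintype V] [DecidableEq Ω] [DecidableEq V] [Nonempty V]
  {edge : Ω → Ω → Prop} [DecidableRel edge] (hwf : WellFounded edge)
  (w : Ω → Ω → ℝ) (P : Ω → V → ℝ) (dist : V → V → ℝ) {K : ℕ} {src : Fin K → Ω} {s : Fin K → V}

/-- The table value is a lower bound for the delay of any embedding. -/
theorem treeH_le_netDelay (hsrc : Function.Injective src)
    (hleaves : ∀ ω, (¬ ∃ ω', edge ω' ω) ↔ ∃ i, src i = ω)
    {E : Ω → V} (hE : ∀ i, E (src i) = s i) (ω : Ω) :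
    treeH edge hwf w P dist src s ω (E ω) ≤ (netDelay edge hwf w P dist E ω : EReal) := by
  induction ω using hwf.induction with
  | _ ω ih =>
    by_cases hω : ∃ i, src i = ω
    · rw [netDelay_of_forall_not_edge edge hwf w P dist E (not_exists.mp ((hleaves ω).mpr hω))]
      obtain ⟨i, rfl⟩ := hω
      simp [treeH_src edge hwf w P dist s hsrc, hE]
    · have hne := filter_edge_nonempty_of_not_src hleaves hω
      rw [treeH_of_nonempty edge hwf w P dist s hω hne, netDelay_of_nonempty edge hwf w P dist E hne,
        add_comm, EReal.coe_add]
      refine add_le_add (Finset.sup'_le _ _ fun ω' hω' => ?_) le_rfl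
      refine (Finset.inf'_le _ (Finset.mem_univ (E ω'))).trans ?_
      refine (add_le_add (ih ω' (Finset.mem_filter.mp hω').2) le_rfl).trans ?_
      rw [← EReal.coe_add, EReal.coe_le_coe_iff]
      exact Finset.le_sup' (fun ω' => netDelay edge hwf w P dist E ω' +
        w ω' ω * dist (E ω') (E ω)) hω'

theorem exists_treeH_lt_top (hsrc : Function.Injective src)
    (hleaves : ∀ ω, (¬ ∃ ω', edge ω' ω) ↔ ∃ i, src i = ω) (ω : Ω) :
    ∃ v, treeH edge hwf w P dist src s ω v < ⊤ := by
  induction ω using hwf.induction with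
  | _ ω ih =>
    by_cases hω : ∃ i, src i = ω
    · obtain ⟨i, rfl⟩ := hω
      exact ⟨s i, by simp [treeH_src edge hwf w P dist s hsrc]⟩
    · have hne := filter_edge_nonempty_of_not_src hleaves hω
      refine ⟨Classical.arbitrary V, ?_⟩
      rw [treeH_of_nonempty edge hwf w P dist s hω hne]
      refine EReal.add_lt_top (EReal.coe_ne_top _) (ne_of_lt ?_)
      refine (Finset.sup'_lt_iff _).mpr fun ω' hω' => ?_
      obtain ⟨u, hu⟩ := ih ω' (Finset.mem_filter.mp hω').2
      exact (Finset.inf'_le _ (Finset.mem_univ u)).trans_lt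
        (EReal.add_lt_top hu.ne (EReal.coe_ne_top _))

/-- If every vertex is placed at a minimizer of the recursion given the placement of its
successor, the delay does not exceed the table value. -/
theorem netDelay_le_treeH (hsrc : Function.Injective src)
    (hleaves : ∀ ω, (¬ ∃ ω', edge ω' ω) ↔ ∃ i, src i = ω)
    {E : Ω → V} (hE : ∀ i, E (src i) = s i)
    (hmin : ∀ ω' ω, edge ω' ω → ∀ u,
      treeH edge hwf w P dist src s ω' (E ω') + ((w ω' ω * dist (E ω') (E ω) : ℝ) : EReal) ≤
        treeH edge hwf w P dist src s ω' u + ((w ω' ω * dist u (E ω) : ℝ) : EReal)) (ω : Ω) :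
    (netDelay edge hwf w P dist E ω : EReal) ≤ treeH edge hwf w P dist src s ω (E ω) := by
  induction ω using hwf.induction with
  | _ ω ih =>
    by_cases hω : ∃ i, src i = ω
    · rw [netDelay_of_forall_not_edge edge hwf w P dist E (not_exists.mp ((hleaves ω).mpr hω))]
      obtain ⟨i, rfl⟩ := hω
      simp [treeH_src edge hwf w P dist s hsrc, hE]
    · have hne := filter_edge_nonempty_of_not_src hleaves hω
      rw [treeH_of_nonempty edge hwf w P dist s hω hne, netDelay_of_nonempty edge hwf w P dist E hne,
        add_comm, EReal.coe_add]
      refine add_le_add le_rfl ?_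
      obtain ⟨ω', hω', hmax⟩ := Finset.exists_mem_eq_sup' hne fun ω' =>
        netDelay edge hwf w P dist E ω' + w ω' ω * dist (E ω') (E ω)
      have he := (Finset.mem_filter.mp hω').2
      rw [hmax, EReal.coe_add]
      refine le_trans (Finset.le_inf' _ _ fun u _ => ?_)
        (Finset.le_sup' (fun ω' => Finset.univ.inf' Finset.univ_nonempty fun u =>
          treeH edge hwf w P dist src s ω' u + ((w ω' ω * dist u (E ω) : ℝ) : EReal)) hω')
      exact (add_le_add (ih ω' he) le_rfl).trans (hmin ω' ω he u)

end DynamicProgram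

theorem WellFounded.swap_of_finite {α : Type*} [Finite α] {r : α → α → Prop}
    (h : WellFounded r) : WellFounded (Function.swap r) := by
  have hirrefl : Std.Irrefl (Relation.TransGen (Function.swap r)) :=
    ⟨fun a ha => h.transGen.irrefl.irrefl a (Relation.transGen_swap.mp ha)⟩
  have htrans : IsTrans α (Relation.TransGen (Function.swap r)) := inferInstance
  exact Subrelation.wf (fun h => Relation.TransGen.single h)
    (Finite.wellFounded_of_trans_of_irrefl (Relation.TransGen (Function.swap r)))

/-- In a finite in-tree with root `r`, values can be propagated from the root towards the leaves. -/
theorem exists_propagate_from_root {α β : Type*} [Finite α] {edge : α → α → Prop}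
    (hwf : WellFounded edge) {r : α} (hout : ∀ a, a ≠ r → ∃! b, edge a b)
    (hr : ∀ b, ¬ edge r b) (x : β) (f : α → α → β → β) :
    ∃ g : α → β, g r = x ∧ ∀ a b, edge a b → g a = f a b (g b) := by
  classical
  let g : α → β := hwf.swap_of_finite.fix fun a ih =>
    if h : ∃ b, edge a b then f a h.choose (ih h.choose h.choose_spec) else x
  have hg (a : α) : g a = if h : ∃ b, edge a b then f a h.choose (g h.choose) else x :=
    hwf.swap_of_finite.fix_eq _ a
  refine ⟨g, ?_, fun a b hab => ?_⟩
  · rw [hg, dif_neg (not_exists.mpr hr)]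
  · have h : ∃ b, edge a b := ⟨b, hab⟩
    have ha : a ≠ r := by
      rintro rfl
      exact hr b hab
    rw [hg, dif_pos h, (hout a ha).unique h.choose_spec hab]

/-- Correctness of the dynamic program for minimum-delay embedding of a tree computation
graph: if the computation DAG is a tree whose leaves are exactly the sources, every non-root
vertex has exactly one outgoing edge, and the root is the sink `snk`, then the table value
`treeH … snk t` is precisely the minimum of the delay over all embeddings (and the minimum is
attained). -/
theorem minDelay_tree_dynamic_program
    {Ω V : Type*} [Fintype Ω] [Fintype V] [DecidableEq Ω] [DecidableEq V] [Nonempty V]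
    (edge : Ω → Ω → Prop) [DecidableRel edge] (hwf : WellFounded edge)
    (w : Ω → Ω → ℝ) (hw : ∀ a b, 0 ≤ w a b)
    (P : Ω → V → ℝ) (hP : ∀ a v, 0 ≤ P a v)
    (dist : V → V → ℝ) (hdist : ∀ u v, 0 ≤ dist u v)
    (hdist_refl : ∀ u, dist u u = 0)
    (hdist_symm : ∀ u v, dist u v = dist v u)
    (hdist_tri : ∀ u v x, dist u x ≤ dist u v + dist v x)
    (K : ℕ) (src : Fin K → Ω) (hsrc_inj : Function.Injective src)
    (snk : Ω) (hsnk_not_src : ∀ i, src i ≠ snk)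
    (hleaves : ∀ ω, (¬ ∃ ω', edge ω' ω) ↔ ∃ i, src i = ω)
    (hout : ∀ ω, ω ≠ snk → ∃! ω', edge ω ω')
    (hsnk_max : ∀ ω', ¬ edge snk ω')
    (s : Fin K → V) (hs_inj : Function.Injective s) (t : V) :
    IsLeast
      {d : EReal | ∃ E : Ω → V, (∀ i, E (src i) = s i) ∧ E snk = t ∧
        d = ((netDelay edge hwf w P dist E snk : ℝ) : EReal)}
      (treeH edge hwf w P dist src s snk t) := by
  refine ⟨?_, ?_⟩
  · have hargmin (a b : Ω) (v : V) := Finite.exists_min fun u =>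
      treeH edge hwf w P dist src s a u + ((w a b * dist u v : ℝ) : EReal)
    choose f hf using hargmin
    obtain ⟨E, hEt, hE⟩ := exists_propagate_from_root hwf hout hsnk_max t f
    have hmin (a b : Ω) (hab : edge a b) (u : V) :
        treeH edge hwf w P dist src s a (E a) + ((w a b * dist (E a) (E b) : ℝ) : EReal) ≤
          treeH edge hwf w P dist src s a u + ((w a b * dist u (E b) : ℝ) : EReal) := by
      rw [hE a b hab]
      exact hf a b (E b) u
    have hEs (i : Fin K) : E (src i) = s i := by
      obtain ⟨b, hb, -⟩ := hout (src i) (hsnk_not_src i)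
      obtain ⟨u, hu⟩ := exists_treeH_lt_top hwf w P dist (s := s) hsrc_inj hleaves (src i)
      by_contra hne
      have hlt := (hmin _ b hb u).trans_lt (EReal.add_lt_top hu.ne (EReal.coe_ne_top _))
      rw [treeH_src edge hwf w P dist s hsrc_inj, if_neg hne, EReal.top_add_coe] at hlt
      exact hlt.false
    refine ⟨E, hEs, hEt, ?_⟩
    rw [← hEt]
    exact le_antisymm (treeH_le_netDelay hwf w P dist hsrc_inj hleaves hEs snk)
      (netDelay_le_treeH hwf w P dist hsrc_inj hleaves hEs hmin snk)
  · rintro _ ⟨E, hEs, rfl, rfl⟩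
    exact treeH_le_netDelay hwf w P dist hsrc_inj hleaves hEs snk
end

section
/- Suppose the computation graph G is a layered graph with layers L₁,…,L_r (r ≥ 2), where every edge of G goes from a vertex in some layer L_l to a vertex in layer L_{l+1}, all sources lie in L₁ and the sink ω_p lies in L_r, all edge weights are 1, and all processing costs are 0. For maps x_l: L_l → V and x_{l+1}: L_{l+1} → V define d_l(x_l, x_{l+1}) = Σ over edges (a,b) ∈ Γ with a ∈ L_l, b ∈ L_{l+1} of D_{x_l(a), x_{l+1}(b)}. Define h₁(y) = min over maps x₁: L₁ → V with x₁(ω_i) = s_i for every source ω_i of d₁(x₁, y), and for 2 ≤ l ≤ r−1 define h_l(y) = min over maps x: L_l → V of (h_{l-1}(x) + d_l(x, y)). Then the minimum of the cost C(E) over all embeddings E of G into N equals the minimum of h_{r-1}(x_r) over maps x_r: L_r → V with x_r(ω_p) = t. -/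
/-- The cost of an embedding `E` of the computation graph (edge relation `edge`, edge weights
`w`, processing costs `P`) into a network with shortest-path distances `dist`:
`Σ_ω P(ω, E ω) + Σ_{(a,b) ∈ Γ} w(a,b) · dist(E a, E b)`. -/
noncomputable def netCost {Ω V : Type*} [Fintype Ω]
    (edge : Ω → Ω → Prop) [DecidableRel edge]
    (w : Ω → Ω → ℝ) (P : Ω → V → ℝ) (dist : V → V → ℝ) (E : Ω → V) : ℝ :=
  (∑ ω, P ω (E ω)) +
    ∑ q ∈ Finset.univ.filter (fun q : Ω × Ω => edge q.1 q.2),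
      w q.1 q.2 * dist (E q.1) (E q.2)

/-- `layerD … l x y = Σ` over edges `(a,b)` with `a` in layer `l` and `b` in layer `l+1` of
`dist (x a) (y b)`: the interaction cost between the placement `x` of layer `l` and the
placement `y` of layer `l+1` (unit edge weights). -/
noncomputable def layerD {Ω V : Type*} [Fintype Ω]
    (edgeG : Ω → Ω → Prop) [DecidableRel edgeG]
    (dist : V → V → ℝ) (layer : Ω → ℕ) (l : ℕ)
    (x : {ω : Ω // layer ω = l} → V) (y : {ω : Ω // layer ω = l + 1} → V) : ℝ :=
  ∑ q ∈ Finset.univ.filter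
      (fun q : {ω : Ω // layer ω = l} × {ω : Ω // layer ω = l + 1} => edgeG q.1.1 q.2.1),
    dist (x q.1) (y q.2)

/-- The dynamic-programming tables of the layered-graph minimum-cost algorithm:
`hDP … 1 y` is the minimum of `d₁(x₁, y)` over placements `x₁` of layer `1` that map every
source `ω i` of layer `1` to the source node `s i`, and for `l ≥ 2`,
`hDP … l y = min over placements x of layer l of (hDP … (l-1) x + d_l(x, y))`. -/
noncomputable def hDP {Ω V : Type*} [Fintype Ω] [Fintype V]
    (edgeG : Ω → Ω → Prop) [DecidableRel edgeG]
    (dist : V → V → ℝ) (layer : Ω → ℕ)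
    {K : ℕ} (src : Fin K → Ω) (s : Fin K → V) :
    (l : ℕ) → ({ω : Ω // layer ω = l + 1} → V) → ℝ
  | 0, _ => 0
  | 1, y => sInf {c | ∃ x : {ω : Ω // layer ω = 1} → V,
      (∀ i, ∀ h : layer (src i) = 1, x ⟨src i, h⟩ = s i) ∧
      c = layerD edgeG dist layer 1 x y}
  | (l + 2), y => sInf {c | ∃ x : {ω : Ω // layer ω = l + 2} → V,
      c = hDP edgeG dist layer src s (l + 1) x + layerD edgeG dist layer (l + 2) x y}

/-- The infimum of the values of a real function on a nonempty subset of a finite type is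
attained. -/
theorem isLeast_sInf_setOf_eq_apply {ι : Type*} [Finite ι] (p : ι → Prop) (f : ι → ℝ)
    (hp : ∃ x, p x) :
    IsLeast {c | ∃ x, p x ∧ c = f x} (sInf {c | ∃ x, p x ∧ c = f x}) := by
  have hfin : {c | ∃ x, p x ∧ c = f x}.Finite :=
    (Set.finite_range f).subset (by rintro c ⟨x, -, rfl⟩; exact ⟨x, rfl⟩)
  obtain ⟨x, hx⟩ := hp
  exact ⟨Set.Nonempty.csInf_mem ⟨f x, x, hx, rfl⟩ hfin, fun c hc => csInf_le hfin.bddBelow hc⟩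

section LayeredGraph

variable {Ω V : Type*} [Fintype Ω] (edgeG : Ω → Ω → Prop) [DecidableRel edgeG]
  (dist : V → V → ℝ) (layer : Ω → ℕ)

/-- The cost of the edges leaving the layers `1,…,n` under the placement `E`. -/
noncomputable def prefixCost (n : ℕ) (E : Ω → V) : ℝ :=
  ∑ k ∈ Finset.range n, layerD edgeG dist layer (k + 1) (fun ω => E ω) (fun ω => E ω)

theorem prefixCost_succ (n : ℕ) (E : Ω → V) :
    prefixCost edgeG dist layer (n + 1) E = prefixCost edgeG dist layer n E +
      layerD edgeG dist layer (n + 1) (fun ω => E ω) (fun ω => E ω) :=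
  Finset.sum_range_succ _ _

theorem prefixCost_congr {n : ℕ} {E F : Ω → V} (h : ∀ ω, layer ω ≤ n + 1 → E ω = F ω) :
    prefixCost edgeG dist layer n E = prefixCost edgeG dist layer n F := by
  refine Finset.sum_congr rfl fun k hk => ?_
  have hk := Finset.mem_range.1 hk
  congr 1
  · funext ω
    exact h _ (by have := ω.2; omega)
  · funext ω
    exact h _ (by have := ω.2; omega)

theorem layerD_restrict (hedge_layer : ∀ a b, edgeG a b → layer b = layer a + 1)
    (l : ℕ) (E : Ω → V) :
    layerD edgeG dist layer l (fun ω => E ω) (fun ω => E ω) =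
      ∑ q ∈ Finset.univ.filter (fun q : Ω × Ω => edgeG q.1 q.2) with layer q.1 = l,
        dist (E q.1) (E q.2) := by
  unfold layerD
  refine Finset.sum_bij (fun q _ => (q.1.1, q.2.1)) ?_ ?_ ?_ ?_
  · rintro ⟨a, b⟩ h
    simpa using ⟨by simpa using h, a.2⟩
  · rintro ⟨⟨a, ha⟩, ⟨b, hb⟩⟩ - ⟨⟨c, hc⟩, ⟨d, hd⟩⟩ - h
    simpa using h
  · rintro ⟨a, b⟩ h
    simp only [Finset.mem_filter, Finset.mem_univ, true_and] at h
    exact ⟨(⟨a, h.2⟩, ⟨b, by rw [hedge_layer a b h.1, h.2]⟩), by simpa using h.1, rfl⟩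
  · intros
    rfl

theorem netCost_eq_prefixCost (hedge_layer : ∀ a b, edgeG a b → layer b = layer a + 1)
    (n : ℕ) (hlayer : ∀ ω, 1 ≤ layer ω ∧ layer ω ≤ n + 1) (E : Ω → V) :
    netCost edgeG (fun _ _ => (1 : ℝ)) (fun _ _ => (0 : ℝ)) dist E =
      prefixCost edgeG dist layer n E := by
  simp only [netCost, prefixCost, Finset.sum_const_zero, zero_add, one_mul,
    layerD_restrict edgeG dist layer hedge_layer]
  rw [← Finset.sum_fiberwise_of_maps_to (s := Finset.univ.filter fun q : Ω × Ω => edgeG q.1 q.2)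
    (t := Finset.range n) (g := fun q => layer q.1 - 1)]
  · refine Finset.sum_congr rfl fun k _ => Finset.sum_congr ?_ fun _ _ => rfl
    ext q
    have := hlayer q.1
    simp only [Finset.mem_filter, Finset.mem_univ, true_and, and_congr_right_iff]
    omega
  · intro q hq
    have h := hedge_layer _ _ (Finset.mem_filter.1 hq).2
    have h₁ := hlayer q.1
    have h₂ := hlayer q.2
    rw [Finset.mem_range]
    omega

variable [Fintype V] [Nonempty V] {K : ℕ} (src : Fin K → Ω) (s : Fin K → V)

/-- The table entry `hDP … (n + 1) y` is the least cost of the first `n + 1` layers of edges over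
all placements that respect the sources and restrict to `y` on layer `n + 2`. -/
theorem isLeast_hDP (hsrc_inj : Function.Injective src) (hsrc_layer : ∀ i, layer (src i) = 1)
    (n : ℕ) (y : {ω : Ω // layer ω = n + 1 + 1} → V) :
    IsLeast {c | ∃ E : Ω → V, (∀ i, E (src i) = s i) ∧
        (fun ω : {ω : Ω // layer ω = n + 1 + 1} => E ω) = y ∧
        c = prefixCost edgeG dist layer (n + 1) E}
      (hDP edgeG dist layer src s (n + 1) y) := by
  classical
  obtain ⟨v⟩ := ‹Nonempty V›
  induction n with
  | zero =>
    have key := isLeast_sInf_setOf_eq_apply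
      (fun x : {ω : Ω // layer ω = 1} → V =>
        ∀ i, ∀ h : layer (src i) = 1, x ⟨src i, h⟩ = s i)
      (fun x => layerD edgeG dist layer 1 x y)
      ⟨fun ω => Function.extend src s (fun _ => v) ω, fun i _ => hsrc_inj.extend_apply _ _ i⟩
    have hpre : ∀ E : Ω → V, prefixCost edgeG dist layer (0 + 1) E =
        layerD edgeG dist layer 1 (fun ω => E ω) (fun ω => E ω) := fun E => by
      simp [prefixCost]
    rw [hDP]
    constructor
    · obtain ⟨x, hx, hc⟩ := key.1
      refine ⟨fun ω => if h : layer ω = 1 then x ⟨ω, h⟩ else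
        if h : layer ω = 0 + 1 + 1 then y ⟨ω, h⟩ else v, fun i => ?_, ?_, ?_⟩
      · simp [hsrc_layer i, hx]
      · funext ω
        have h₁ : layer ω ≠ 1 := by have := ω.2; omega
        exact (dif_neg h₁).trans (dif_pos ω.2)
      · rw [hpre, hc]
        congr 1
        · funext ω
          rw [dif_pos ω.2]
        · funext ω
          have h₁ : layer ω ≠ 1 := by have := ω.2; omega
          rw [dif_neg h₁, dif_pos ω.2]
    · rintro c ⟨E, hE, rfl, rfl⟩
      exact key.2 ⟨fun ω => E ω, fun i _ => hE i, hpre E⟩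
  | succ n ih =>
    have key := isLeast_sInf_setOf_eq_apply
      (fun _ : {ω : Ω // layer ω = n + 2} → V => True)
      (fun x => hDP edgeG dist layer src s (n + 1) x + layerD edgeG dist layer (n + 2) x y)
      ⟨fun _ => v, trivial⟩
    simp only [true_and] at key
    rw [hDP]
    constructor
    · obtain ⟨x, hc⟩ := key.1
      obtain ⟨E, hE, hEx, hEc⟩ := (ih x).1
      refine ⟨fun ω => if h : layer ω = n + 1 + 1 + 1 then y ⟨ω, h⟩ else E ω,
        fun i => ?_, ?_, ?_⟩
      · simp [hsrc_layer i, hE]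
      · funext ω
        exact dif_pos ω.2
      · rw [prefixCost_succ, hc, hEc]
        congr 1
        · refine prefixCost_congr _ _ _ fun ω hω => ?_
          rw [dif_neg (by omega)]
        · congr 1
          · funext ω
            rw [dif_neg (by have := ω.2; omega), ← hEx]
          · funext ω
            rw [dif_pos ω.2]
    · rintro c ⟨E, hE, rfl, rfl⟩
      rw [prefixCost_succ]
      exact (key.2 ⟨fun ω => E ω, rfl⟩).trans
        (add_le_add_left ((ih fun ω => E ω).2 ⟨E, hE, rfl, rfl⟩) _)

end LayeredGraph

/-- Correctness of the layered-graph dynamic program for minimum-cost embedding: if the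
computation graph is layered with layers `1,…,r`, every edge going from a layer `l` to layer
`l+1`, all sources in layer `1`, the sink `snk` in layer `r`, unit edge weights and zero
processing costs, then the minimum cost over all embeddings equals the minimum of
`hDP … (r-1) x_r` over placements `x_r` of the last layer mapping `snk` to `t`. -/
theorem minCost_layered_dynamic_program
    {Ω V : Type*} [Fintype Ω] [Fintype V] [Nonempty V]
    (edgeG : Ω → Ω → Prop) [DecidableRel edgeG]
    (dist : V → V → ℝ) (hdist : ∀ u v, 0 ≤ dist u v)
    (hdist_refl : ∀ u, dist u u = 0)
    (hdist_symm : ∀ u v, dist u v = dist v u)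
    (hdist_tri : ∀ u v x, dist u x ≤ dist u v + dist v x)
    (r : ℕ) (hr : 2 ≤ r) (layer : Ω → ℕ)
    (hlayer : ∀ ω, 1 ≤ layer ω ∧ layer ω ≤ r)
    (hedge_layer : ∀ a b, edgeG a b → layer b = layer a + 1)
    (K : ℕ) (src : Fin K → Ω) (hsrc_inj : Function.Injective src)
    (hsrc_layer : ∀ i, layer (src i) = 1)
    (hsrc_min : ∀ i ω, ¬ edgeG ω (src i))
    (snk : Ω) (hsnk_layer : layer snk = r) (hsnk_max : ∀ ω, ¬ edgeG snk ω)
    (s : Fin K → V) (hs_inj : Function.Injective s) (t : V) :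
    sInf {c : ℝ | ∃ E : Ω → V, (∀ i, E (src i) = s i) ∧ E snk = t ∧
        c = netCost edgeG (fun _ _ => (1 : ℝ)) (fun _ _ => (0 : ℝ)) dist E}
      = sInf {c : ℝ | ∃ xr : {ω : Ω // layer ω = (r - 1) + 1} → V,
          (∀ h : layer snk = (r - 1) + 1, xr ⟨snk, h⟩ = t) ∧
          c = hDP edgeG dist layer src s (r - 1) xr} := by
  obtain ⟨n, rfl⟩ := Nat.exists_eq_add_of_le' hr
  change _ = sInf {c : ℝ | ∃ xr : {ω : Ω // layer ω = n + 1 + 1} → V,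
    (∀ h : layer snk = n + 1 + 1, xr ⟨snk, h⟩ = t) ∧
      c = hDP edgeG dist layer src s (n + 1) xr}
  have key := isLeast_sInf_setOf_eq_apply
    (fun x : {ω : Ω // layer ω = n + 1 + 1} → V =>
      ∀ h : layer snk = n + 1 + 1, x ⟨snk, h⟩ = t)
    (fun x => hDP edgeG dist layer src s (n + 1) x) ⟨fun _ => t, fun _ => rfl⟩
  have hDP_least := isLeast_hDP edgeG dist layer src s hsrc_inj hsrc_layer n
  simp only [netCost_eq_prefixCost edgeG dist layer hedge_layer (n + 1) hlayer]
  refine IsLeast.csInf_eq ⟨?_, ?_⟩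
  · obtain ⟨x, hx, hc⟩ := key.1
    obtain ⟨E, hE, rfl, hEc⟩ := (hDP_least x).1
    exact ⟨E, hE, hx hsnk_layer, hc.trans hEc⟩
  · rintro c ⟨E, hE, hEt, rfl⟩
    exact (key.2 ⟨fun ω => E ω, fun _ => hEt, rfl⟩).trans
      ((hDP_least _).2 ⟨E, hE, rfl, rfl⟩)
end

section
/- Suppose the computation graph G is a layered graph with layers L₁,…,L_r (r ≥ 2), each layer containing at most k vertices, where every edge of G goes from a vertex in some layer L_l to a vertex in layer L_{l+1}, every vertex in layer L_l for l ≥ 2 has at least one predecessor (in layer L_{l-1}), all sources lie in L₁, the sink lies in L_r, and all processing costs are 0. Let E be an embedding and suppose there is a constant δ ≥ 0 such that w(a,b)·D_{E(a),E(b)} = δ for every edge (a,b) ∈ Γ. Then C(E) ≤ k²·d(E). -/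
theorem netDelay_eq {Ω V : Type*} [Fintype Ω]
    (edge : Ω → Ω → Prop) [DecidableRel edge] (hwf : WellFounded edge)
    (w : Ω → Ω → ℝ) (P : Ω → V → ℝ) (dist : V → V → ℝ) (E : Ω → V) (ω : Ω) :
    netDelay edge hwf w P dist E ω =
      if h : (Finset.univ.filter fun ω' => edge ω' ω).Nonempty then
        (Finset.univ.filter fun ω' => edge ω' ω).sup' h
          (fun ω' => (if edge ω' ω then netDelay edge hwf w P dist E ω' else 0)
            + w ω' ω * dist (E ω') (E ω)) + P ω (E ω)
      else 0 := by
  unfold netDelay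
  rw [hwf.fix_eq]
  rfl

/-- With zero processing costs and constant delay `δ` per edge, the delay at a vertex of a layered
graph is `δ` times the number of layers preceding it. -/
theorem netDelay_eq_layer_mul {Ω V : Type*} [Fintype Ω]
    (edge : Ω → Ω → Prop) [DecidableRel edge] (hwf : WellFounded edge)
    (w : Ω → Ω → ℝ) (dist : V → V → ℝ) (layer : Ω → ℕ)
    (hlayer : ∀ ω, 1 ≤ layer ω)
    (hedge_layer : ∀ a b, edge a b → layer b = layer a + 1)
    (hpred : ∀ ω, 2 ≤ layer ω → ∃ ω', edge ω' ω)
    (E : Ω → V) (δ : ℝ)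
    (hconst : ∀ a b, edge a b → w a b * dist (E a) (E b) = δ) (ω : Ω) :
    netDelay edge hwf w (fun _ _ => (0 : ℝ)) dist E ω = ((layer ω : ℝ) - 1) * δ := by
  induction ω using hwf.induction with
  | _ ω ih =>
  rw [netDelay_eq]
  split_ifs with h
  · rw [add_zero]
    refine (Finset.sup'_congr h rfl fun a ha => ?_).trans
      (Finset.sup'_const h (((layer ω : ℝ) - 1) * δ))
    have hab : edge a ω := (Finset.mem_filter.1 ha).2
    rw [if_pos hab, ih a hab, hconst a ω hab, hedge_layer a ω hab]
    push_cast
    ring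
  · have h1 : layer ω = 1 := by
      by_contra hne
      obtain ⟨a, ha⟩ := hpred ω (by have := hlayer ω; omega)
      exact h ⟨a, by simpa using ha⟩
    simp [h1]

/-- A layered graph with layers `1,…,r` of width at most `k` has at most `k² (r - 1)` edges. -/
theorem card_edges_le_of_layered {Ω : Type*} [Fintype Ω]
    (edge : Ω → Ω → Prop) [DecidableRel edge] (r k : ℕ) (layer : Ω → ℕ)
    (hlayer : ∀ ω, 1 ≤ layer ω ∧ layer ω ≤ r)
    (hwidth : ∀ l, (Finset.univ.filter fun ω => layer ω = l).card ≤ k)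
    (hedge_layer : ∀ a b, edge a b → layer b = layer a + 1) :
    (Finset.univ.filter fun q : Ω × Ω => edge q.1 q.2).card ≤ k ^ 2 * (r - 1) := by
  have hmaps : ∀ q ∈ Finset.univ.filter (fun q : Ω × Ω => edge q.1 q.2),
      layer q.1 ∈ Finset.Icc 1 (r - 1) := by
    intro q hq
    have h := hedge_layer q.1 q.2 (Finset.mem_filter.1 hq).2
    have h1 := hlayer q.1
    have h2 := hlayer q.2
    rw [Finset.mem_Icc]
    omega
  have hfiber : ∀ l ∈ Finset.Icc 1 (r - 1),
      ((Finset.univ.filter fun q : Ω × Ω => edge q.1 q.2).filter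
        fun q => layer q.1 = l).card ≤ k ^ 2 := by
    intro l _
    calc _ ≤ ((Finset.univ.filter fun ω => layer ω = l) ×ˢ
            (Finset.univ.filter fun ω => layer ω = l + 1)).card := by
          refine Finset.card_le_card fun q hq => ?_
          simp only [Finset.mem_filter, Finset.mem_univ, true_and, Finset.mem_product] at hq ⊢
          exact ⟨hq.2, by rw [hedge_layer q.1 q.2 hq.1, hq.2]⟩
      _ ≤ k ^ 2 := by
          rw [Finset.card_product, sq]
          exact Nat.mul_le_mul (hwidth l) (hwidth (l + 1))
  simpa using Finset.card_le_mul_card_image_of_maps_to hmaps (k ^ 2) hfiber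

/-- For a layered computation graph with layers `1,…,r`, at most `k` vertices per layer,
every edge going from a layer `l` to layer `l+1`, every vertex in a layer `l ≥ 2` having at
least one predecessor, all sources in layer `1`, the sink in layer `r`, and zero processing
costs: if an embedding `E` incurs the same delay `δ ≥ 0` on every edge (that is,
`w(a,b) · dist(E a, E b) = δ` for every edge `(a,b)`), then `C(E) ≤ k² · d(E)`. -/
theorem cost_le_ksq_delay_uniform_edge_delay
    {Ω V : Type*} [Fintype Ω] [Fintype V]
    (edge : Ω → Ω → Prop) [DecidableRel edge] (hwf : WellFounded edge)
    (w : Ω → Ω → ℝ) (hw : ∀ a b, 0 ≤ w a b)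
    (dist : V → V → ℝ) (hdist : ∀ u v, 0 ≤ dist u v)
    (r : ℕ) (hr : 2 ≤ r) (k : ℕ) (layer : Ω → ℕ)
    (hlayer : ∀ ω, 1 ≤ layer ω ∧ layer ω ≤ r)
    (hwidth : ∀ l, (Finset.univ.filter fun ω => layer ω = l).card ≤ k)
    (hedge_layer : ∀ a b, edge a b → layer b = layer a + 1)
    (hpred : ∀ ω, 2 ≤ layer ω → ∃ ω', edge ω' ω)
    (K : ℕ) (src : Fin K → Ω) (hsrc_layer : ∀ i, layer (src i) = 1)
    (snk : Ω) (hsnk_layer : layer snk = r)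
    (s : Fin K → V) (t : V)
    (E : Ω → V) (hEsrc : ∀ i, E (src i) = s i) (hEsnk : E snk = t)
    (δ : ℝ) (hδ : 0 ≤ δ)
    (hconst : ∀ a b, edge a b → w a b * dist (E a) (E b) = δ) :
    netCost edge w (fun _ _ => (0 : ℝ)) dist E
      ≤ (k : ℝ) ^ 2 * netDelay edge hwf w (fun _ _ => (0 : ℝ)) dist E snk := by
  rw [netDelay_eq_layer_mul edge hwf w dist layer (fun ω => (hlayer ω).1) hedge_layer hpred E δ
    hconst snk, hsnk_layer]
  have hcost : netCost edge w (fun _ _ => (0 : ℝ)) dist E =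
      ((Finset.univ.filter fun q : Ω × Ω => edge q.1 q.2).card : ℝ) * δ := by
    unfold netCost
    rw [Finset.sum_const_zero, zero_add, Finset.sum_congr rfl fun q hq =>
      hconst q.1 q.2 (Finset.mem_filter.1 hq).2, Finset.sum_const, nsmul_eq_mul]
  have hcard : ((Finset.univ.filter fun q : Ω × Ω => edge q.1 q.2).card : ℝ) ≤
      (k : ℝ) ^ 2 * ((r : ℝ) - 1) := by
    have h := card_edges_le_of_layered edge r k layer hlayer hwidth hedge_layer
    rw [← Nat.cast_pred (show 0 < r by omega)]
    exact_mod_cast h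
  rw [hcost, ← mul_assoc]
  exact mul_le_mul_of_nonneg_right hcard hδ
end
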